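/- arXiv:1009.4286 — 3 statements merged into one kernel-verified Lean document; each statement's English description precedes it below -/
import Mathlib

section
/- Suppose (ε_n) is a sequence of positive numbers with ε_n → 0, P(H > M_n)^{−(1−β)} ε_n → 0 and P(H > M_n)^{−(1−β)} (l(γM_n(1+ε_n))/l(γM_n) − 1) → 0. Then p_n := P(γM_n < H ≤ γ(1+ε_n)M_n) = o(P(H > M_n)^{2−β}) as n → ∞. -/
open MeasureTheory ProbabilityTheory Filter Topology Set Asymptotics

noncomputable section

variable {Ω : Type*} [MeasureSpace Ω]

/-- The `k`-th largest order statistic (1-indexed) of the finite sample `f`,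
so `orderStat f 1 ≥ orderStat f 2 ≥ … ≥ orderStat f n`. -/
def orderStat {n : ℕ} (f : Fin n → ℝ) (k : ℕ) : ℝ :=
  if h : n - k < n then f (Tuple.sort f ⟨n - k, h⟩) else 0

/-- The Hill statistic `h(k,n) = (1/k) ∑_{i=1}^k log (X_{(i)} / X_{(k)})`. -/
def hill {n : ℕ} (f : Fin n → ℝ) (k : ℕ) : ℝ :=
  (k : ℝ)⁻¹ * ∑ i ∈ Finset.Icc 1 k, Real.log (orderStat f i / orderStat f k)

/-- Tail probability `x ↦ P(Z > x)`. -/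
def tailP (Z : Ω → ℝ) (x : ℝ) : ℝ := (ℙ {ω | Z ω > x}).toReal

/-- `b(y) := inf {x : 1/P(H > x) ≥ y}`. -/
def bq (Z : Ω → ℝ) (y : ℝ) : ℝ := sInf {x : ℝ | 1 / tailP Z x ≥ y}

/-- `l(x) := x^α P(H > x)`. -/
def ell (α : ℝ) (Z : Ω → ℝ) (x : ℝ) : ℝ := x ^ α * tailP Z x

/-- The tail of `H` is regularly varying with index `-α`. -/
def RegVarTail (H0 : Ω → ℝ) (α : ℝ) : Prop :=
  ∀ x : ℝ, 0 < x → Tendsto (fun t => tailP H0 (t * x) / tailP H0 t) atTop (𝓝 (x ^ (-α)))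

/-- A function is regularly varying (at infinity) with index `σ`. -/
def RegVarFun (A : ℝ → ℝ) (σ : ℝ) : Prop :=
  ∀ x : ℝ, 0 < x → Tendsto (fun t => A (t * x) / A t) atTop (𝓝 (x ^ σ))

lemma tailP_antitone [IsFiniteMeasure (ℙ : Measure Ω)] (Z : Ω → ℝ) : Antitone (tailP Z) :=
  fun _ _ hxy => measureReal_mono fun _ h => lt_of_le_of_lt hxy h

lemma tailP_pos [IsFiniteMeasure (ℙ : Measure Ω)] {Z : Ω → ℝ} {α : ℝ}
    (hreg : RegVarTail Z α) (x : ℝ) : 0 < tailP Z x := by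
  have h := hreg 1 one_pos
  simp only [mul_one, Real.one_rpow] at h
  obtain ⟨t, ht, hxt⟩ := ((h.eventually_ne one_ne_zero).and (eventually_ge_atTop x)).exists
  have h0 : tailP Z t ≠ 0 := fun h0 => ht (by simp [h0])
  exact (lt_of_le_of_ne ENNReal.toReal_nonneg h0.symm).trans_le (tailP_antitone Z hxt)

lemma toReal_prob_interval_eq_tailP_sub [IsFiniteMeasure (ℙ : Measure Ω)] {Z : Ω → ℝ}
    (hZ : Measurable Z) {a b : ℝ} (hab : a ≤ b) :
    (ℙ {ω | a < Z ω ∧ Z ω ≤ b}).toReal = tailP Z a - tailP Z b := by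
  have hset : {ω | a < Z ω ∧ Z ω ≤ b} = {ω | Z ω > a} \ {ω | Z ω > b} := by
    ext ω
    simp
  rw [hset]
  exact measureReal_sdiff (fun ω h => lt_of_le_of_lt hab h) (measurableSet_lt measurable_const hZ)

lemma tailP_mul_eq_rpow_mul_ell_ratio (Z : Ω → ℝ) (α : ℝ) {a s : ℝ} (ha : 0 < a) (hs : 0 < s)
    (hT : tailP Z a ≠ 0) :
    tailP Z (a * s) = tailP Z a * (s ^ (-α) * (ell α Z (a * s) / ell α Z a)) := by
  have h1 : a ^ α ≠ 0 := (Real.rpow_pos_of_pos ha α).ne'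
  have h2 : s ^ α ≠ 0 := (Real.rpow_pos_of_pos hs α).ne'
  rw [ell, ell, Real.mul_rpow ha.le hs.le, Real.rpow_neg hs.le]
  field_simp

lemma one_sub_mul_le_rpow_neg {α x : ℝ} (hα : 0 ≤ α) (hx : 0 < 1 + x) :
    1 - α * x ≤ (1 + x) ^ (-α) := by
  rw [Real.rpow_def_of_pos hx]
  have h1 := Real.add_one_le_exp (Real.log (1 + x) * -α)
  have h2 : Real.log (1 + x) ≤ x := by linarith [Real.log_le_sub_one_of_pos hx]
  nlinarith [mul_le_mul_of_nonneg_left h2 hα]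

lemma abs_one_sub_rpow_neg_mul_le {α x : ℝ} (hα : 0 ≤ α) (hx : 0 ≤ x) (r : ℝ) :
    |1 - (1 + x) ^ (-α) * r| ≤ α * x + |r - 1| := by
  have h0 : 0 ≤ (1 + x) ^ (-α) := by positivity
  have h1 : (1 + x) ^ (-α) ≤ 1 :=
    Real.rpow_le_one_of_one_le_of_nonpos (by linarith) (by linarith)
  have h2 := one_sub_mul_le_rpow_neg hα (by linarith : 0 < 1 + x)
  calc |1 - (1 + x) ^ (-α) * r|
      = |(1 - (1 + x) ^ (-α)) - (1 + x) ^ (-α) * (r - 1)| := by ring_nf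
    _ ≤ |1 - (1 + x) ^ (-α)| + |(1 + x) ^ (-α) * (r - 1)| := abs_sub _ _
    _ ≤ α * x + |r - 1| := by
      rw [abs_mul, abs_of_nonneg h0, abs_of_nonneg (sub_nonneg.2 h1)]
      exact add_le_add (by linarith) (mul_le_of_le_one_left (abs_nonneg _) h1)

/-- If `ε_n > 0`, `ε_n → 0`, `P(H > M_n)^{-(1-β)} ε_n → 0` and
`P(H > M_n)^{-(1-β)} (l(γ M_n (1+ε_n))/l(γ M_n) - 1) → 0`, then
`p_n := P(γ M_n < H ≤ γ (1+ε_n) M_n) = o(P(H > M_n)^{2-β})`. -/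
theorem interval_probability_littleO
    {Ω : Type*} [MeasureSpace Ω] [IsProbabilityMeasure (ℙ : Measure Ω)]
    (H0 : Ω → ℝ) (hH0meas : Measurable H0) (hH0nn : ∀ ω, 0 ≤ H0 ω)
    (α β γ : ℝ) (hα : 0 < α) (hβ : β ∈ Ioo (0:ℝ) 1) (hγ : γ ∈ Ioo (0:ℝ) 1)
    (hreg : RegVarTail H0 α)
    (M : ℕ → ℝ) (hMpos : ∀ n, 0 < M n) (hMtop : Tendsto M atTop atTop)
    (ε : ℕ → ℝ) (hεpos : ∀ n, 0 < ε n) (hε0 : Tendsto ε atTop (𝓝 0))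
    (hA1 : Tendsto (fun n : ℕ => tailP H0 (M n) ^ (-(1 - β)) * ε n) atTop (𝓝 0))
    (hA3 : Tendsto (fun n : ℕ => tailP H0 (M n) ^ (-(1 - β)) *
      (ell α H0 (γ * M n * (1 + ε n)) / ell α H0 (γ * M n) - 1)) atTop (𝓝 0)) :
    (fun n : ℕ => (ℙ {ω | γ * M n < H0 ω ∧ H0 ω ≤ γ * (1 + ε n) * M n}).toReal)
      =o[atTop] (fun n : ℕ => tailP H0 (M n) ^ (2 - β)) := by
  have hpos := tailP_pos hreg
  have hratio : Tendsto (fun n => tailP H0 (M n * γ) / tailP H0 (M n)) atTop (𝓝 (γ ^ (-α))) :=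
    (hreg γ hγ.1).comp hMtop
  set r : ℕ → ℝ := fun n => ell α H0 (γ * M n * (1 + ε n)) / ell α H0 (γ * M n)
  have hrel : Tendsto (fun n => tailP H0 (M n) ^ (-(1 - β)) *
      (1 - (1 + ε n) ^ (-α) * r n)) atTop (𝓝 0) := by
    have hbound : Tendsto (fun n => α * (tailP H0 (M n) ^ (-(1 - β)) * ε n) +
        |tailP H0 (M n) ^ (-(1 - β)) * (r n - 1)|) atTop (𝓝 0) := by
      simpa using (hA1.const_mul α).add hA3.abs
    refine squeeze_zero_norm (fun n => ?_) hbound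
    have hc : 0 < tailP H0 (M n) ^ (-(1 - β)) := Real.rpow_pos_of_pos (hpos _) _
    rw [Real.norm_eq_abs, abs_mul, abs_mul, abs_of_pos hc]
    calc _ ≤ _ := mul_le_mul_of_nonneg_left
          (abs_one_sub_rpow_neg_mul_le hα.le (hεpos n).le (r n)) hc.le
      _ = _ := by ring
  rw [isLittleO_iff_tendsto fun n h => absurd h (Real.rpow_pos_of_pos (hpos _) _).ne']
  have hlim := hrel.mul hratio
  rw [zero_mul] at hlim
  refine hlim.congr fun n => ?_
  have ha : 0 < γ * M n := mul_pos hγ.1 (hMpos n)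
  have hε1 : 0 < 1 + ε n := by linarith [hεpos n]
  have hle : γ * M n ≤ γ * M n * (1 + ε n) :=
    le_mul_of_one_le_right ha.le (by linarith [hεpos n])
  have hsplit : tailP H0 (M n) ^ (-(1 - β)) =
      tailP H0 (M n) / tailP H0 (M n) ^ (2 - β) := by
    rw [show -(1 - β) = 1 - (2 - β) by ring, Real.rpow_sub (hpos _), Real.rpow_one]
  have hM := (hpos (M n)).ne'
  have hMβ := (Real.rpow_pos_of_pos (hpos (M n)) (2 - β)).ne'
  rw [mul_right_comm γ, toReal_prob_interval_eq_tailP_sub hH0meas hle,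
    tailP_mul_eq_rpow_mul_ell_ratio H0 α ha hε1 (hpos _).ne', hsplit, mul_comm (M n) γ]
  change _ = (_ - _ * (_ * r n)) / _
  field_simp
end
end

section
/- Under Assumptions B and C, if (u_n) is a sequence of integers with u_n ∼ n P(H > γM_n), and one sets w_n := n − u_n and v_n := [n^{1−β} u_n^β] − u_n, then 1 ≪ w_n P(H > γM_n) ≪ √v_n ≪ √w_n; that is, w_n P(H > γM_n) → ∞, w_n P(H > γM_n)/√v_n → 0, and v_n/w_n → 0, as n → ∞. -/
open MeasureTheory ProbabilityTheory Filter Topology Set Asymptotics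

noncomputable section

variable {Ω : Type*} [MeasureSpace Ω]

/-- Assumption A: there is a sequence `(ε_n)` with
`P(H > M_n)^{-(1-β)} ε_n → 0`, `n P(H > M_n) P(L > ε_n M_n) → 0` and
`P(H > M_n)^{-(1-β)} (l(γ M_n (1+ε_n))/l(γ M_n) - 1) → 0`. -/
def AssumpA (H0 L0 : Ω → ℝ) (M : ℕ → ℝ) (α β γ : ℝ) : Prop :=
  ∃ ε : ℕ → ℝ,
    Tendsto (fun n : ℕ => tailP H0 (M n) ^ (-(1 - β)) * ε n) atTop (𝓝 0) ∧
    Tendsto (fun n : ℕ => (n : ℝ) * tailP H0 (M n) * tailP L0 (ε n * M n)) atTop (𝓝 0) ∧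
    Tendsto (fun n : ℕ => tailP H0 (M n) ^ (-(1 - β)) *
      (ell α H0 (γ * M n * (1 + ε n)) / ell α H0 (γ * M n) - 1)) atTop (𝓝 0)

/-- Assumption B: `n P(H > M_n) → ∞`. -/
def AssumpB (H0 : Ω → ℝ) (M : ℕ → ℝ) : Prop :=
  Tendsto (fun n : ℕ => (n : ℝ) * tailP H0 (M n)) atTop atTop

/-- Assumption C: `n P(H > M_n)^{2-β} (log M_n)² → 0`. -/
def AssumpC (H0 : Ω → ℝ) (M : ℕ → ℝ) (β : ℝ) : Prop :=
  Tendsto (fun n : ℕ => (n : ℝ) * tailP H0 (M n) ^ (2 - β) * Real.log (M n) ^ 2) atTop (𝓝 0)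

/-- Assumption D: for any sequence `(v_n)` with `v_n ∼ n P(H > γ M_n)^β`,
`√v_n [(n/v_n) P(H > b(n/v_n) y^{-1/α}) - y] → 0` uniformly on compact subsets of `[0,∞)`
(with the convention that `P(H > b(n/v_n) · 0^{-1/α}) = P(H > ∞) = 0` at `y = 0`). -/
def AssumpD (H0 : Ω → ℝ) (M : ℕ → ℝ) (α β γ : ℝ) : Prop :=
  ∀ v : ℕ → ℝ,
    Tendsto (fun n : ℕ => v n / ((n : ℝ) * tailP H0 (γ * M n) ^ β)) atTop (𝓝 1) →
    ∀ K : Set ℝ, K ⊆ Ici 0 → IsCompact K →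
      TendstoUniformlyOn
        (fun (n : ℕ) (y : ℝ) => Real.sqrt (v n) *
          (((n : ℝ) / v n) *
              (if y = 0 then 0 else tailP H0 (bq H0 ((n : ℝ) / v n) * y ^ (-α⁻¹))) - y))
        0 atTop K

/-- Assumption E: for any sequence `(v_n)` with `v_n ∼ n P(H > γ M_n)^β`,
`lim_{T→∞} limsup_n √v_n ∫_T^∞ |(n/v_n) P(H > b(n/v_n) s) - s^{-α}| ds/s = 0`. -/
def AssumpE (H0 : Ω → ℝ) (M : ℕ → ℝ) (α β γ : ℝ) : Prop :=
  ∀ v : ℕ → ℝ,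
    Tendsto (fun n : ℕ => v n / ((n : ℝ) * tailP H0 (γ * M n) ^ β)) atTop (𝓝 1) →
    Tendsto (fun T : ℝ =>
        Filter.limsup (fun n : ℕ => Real.sqrt (v n) *
          ∫ s in Ioi T,
            |((n : ℝ) / v n) * tailP H0 (bq H0 ((n : ℝ) / v n) * s) - s ^ (-α)| / s) atTop)
      atTop (𝓝 0)

/-- `w_n := n - u_n`. -/
def wseq (u : ℕ → ℕ) (n : ℕ) : ℕ := n - u n

/-- `v_n := ⌊n^{1-β} u_n^β⌋ - u_n`. -/
def vseq (u : ℕ → ℕ) (β : ℝ) (n : ℕ) : ℕ :=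
  ⌊(n : ℝ) ^ (1 - β) * (u n : ℝ) ^ β⌋₊ - u n

/-- The tail probability of a measurable random variable tends to zero at infinity. -/
lemma tendsto_tailP_atTop {Ω : Type*} [MeasureSpace Ω] [IsProbabilityMeasure (ℙ : Measure Ω)]
    {Z : Ω → ℝ} (hZ : Measurable Z) : Tendsto (tailP Z) atTop (𝓝 0) := by
  have : IsProbabilityMeasure ((ℙ : Measure Ω).map Z) :=
    Measure.isProbabilityMeasure_map hZ.aemeasurable
  have h : tailP Z = fun x => 1 - cdf ((ℙ : Measure Ω).map Z) x := by
    funext x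
    rw [cdf_eq_real, ← probReal_compl_eq_one_sub measurableSet_Iic, compl_Iic,
      map_measureReal_apply hZ measurableSet_Ioi]
    rfl
  rw [h]
  simpa using (tendsto_cdf_atTop ((ℙ : Measure Ω).map Z)).const_sub 1

section RateComparison

variable {q : ℕ → ℝ} {u : ℕ → ℕ} {β : ℝ}

lemma eventually_pos_of_tendsto_mul_atTop
    (hq : Tendsto (fun n : ℕ => (n : ℝ) * q n) atTop atTop) :
    ∀ᶠ n : ℕ in atTop, 0 < (n : ℝ) ∧ 0 < q n := by
  filter_upwards [hq.eventually_gt_atTop 0] with n hn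
  exact (pos_and_pos_or_neg_and_neg_of_mul_pos hn).resolve_right
    fun h => (Nat.cast_nonneg n).not_gt h.1

lemma tendsto_wseq_div (hq0 : Tendsto q atTop (𝓝 0))
    (hq : Tendsto (fun n : ℕ => (n : ℝ) * q n) atTop atTop)
    (hu : Tendsto (fun n : ℕ => (u n : ℝ) / ((n : ℝ) * q n)) atTop (𝓝 1)) :
    Tendsto (fun n : ℕ => (wseq u n : ℝ) / n) atTop (𝓝 1) := by
  have hun : Tendsto (fun n : ℕ => (u n : ℝ) / n) atTop (𝓝 0) := by
    have h := hu.mul hq0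
    rw [mul_zero] at h
    refine h.congr' ?_
    filter_upwards [eventually_pos_of_tendsto_mul_atTop hq] with n ⟨hn, hqn⟩
    field_simp
  have h := hun.const_sub 1
  rw [sub_zero] at h
  refine h.congr' ?_
  filter_upwards [eventually_pos_of_tendsto_mul_atTop hq,
    hun.eventually_lt_const zero_lt_one] with n ⟨hn, _⟩ hlt
  have hle : u n ≤ n := by
    rw [div_lt_one hn] at hlt
    exact_mod_cast hlt.le
  rw [wseq, Nat.cast_sub hle]
  field_simp

lemma tendsto_vseq_div (hβ : β ∈ Ioo (0 : ℝ) 1) (hq0 : Tendsto q atTop (𝓝 0))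
    (hq : Tendsto (fun n : ℕ => (n : ℝ) * q n) atTop atTop)
    (hu : Tendsto (fun n : ℕ => (u n : ℝ) / ((n : ℝ) * q n)) atTop (𝓝 1)) :
    Tendsto (fun n : ℕ => (vseq u β n : ℝ) / ((n : ℝ) * q n ^ β)) atTop (𝓝 1) := by
  have hpos := eventually_pos_of_tendsto_mul_atTop hq
  have hden : Tendsto (fun n : ℕ => (n : ℝ) * q n ^ β) atTop atTop := by
    refine tendsto_atTop_mono' _ ?_ hq
    filter_upwards [hpos, hq0.eventually_lt_const zero_lt_one] with n ⟨hn, hqn⟩ hq1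
    gcongr
    simpa using Real.rpow_le_rpow_of_exponent_ge hqn hq1.le hβ.2.le
  have hmain : Tendsto (fun n : ℕ => ((n : ℝ) ^ (1 - β) * (u n : ℝ) ^ β) / ((n : ℝ) * q n ^ β))
      atTop (𝓝 1) := by
    have h := hu.rpow_const (p := β) (Or.inl one_ne_zero)
    rw [Real.one_rpow] at h
    refine h.congr' ?_
    filter_upwards [hpos] with n ⟨hn, hqn⟩
    rw [Real.div_rpow (Nat.cast_nonneg _) (by positivity), Real.mul_rpow hn.le hqn.le,
      Real.rpow_sub hn, Real.rpow_one]
    field_simp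
  have hfloor : Tendsto
      (fun n : ℕ => (⌊(n : ℝ) ^ (1 - β) * (u n : ℝ) ^ β⌋₊ : ℝ) / ((n : ℝ) * q n ^ β))
      atTop (𝓝 1) := by
    have h := hmain.sub hden.inv_tendsto_atTop
    rw [sub_zero] at h
    refine tendsto_of_tendsto_of_tendsto_of_le_of_le' h hmain ?_ ?_
    · filter_upwards [hpos] with n ⟨hn, hqn⟩
      rw [Pi.inv_apply, ← one_div, ← sub_div]
      gcongr
      exact (Nat.sub_one_lt_floor _).le
    · filter_upwards [hpos] with n ⟨hn, hqn⟩
      gcongr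
      exact Nat.floor_le (by positivity)
  have hsmall : Tendsto (fun n : ℕ => (u n : ℝ) / ((n : ℝ) * q n ^ β)) atTop (𝓝 0) := by
    have h := hu.mul (hq0.rpow_const (p := 1 - β) (Or.inr (sub_nonneg.2 hβ.2.le)))
    rw [Real.zero_rpow (sub_pos.2 hβ.2).ne', mul_zero] at h
    refine h.congr' ?_
    filter_upwards [hpos] with n ⟨hn, hqn⟩
    rw [Real.rpow_sub hqn, Real.rpow_one]
    field_simp
  have h := hfloor.sub hsmall
  rw [sub_zero] at h
  refine h.congr' ?_
  filter_upwards [hpos, h.eventually_const_lt zero_lt_one] with n ⟨hn, hqn⟩ hlt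
  have hle : u n ≤ ⌊(n : ℝ) ^ (1 - β) * (u n : ℝ) ^ β⌋₊ := by
    rw [← sub_div, div_pos_iff_of_pos_right (by positivity), sub_pos] at hlt
    exact_mod_cast hlt.le
  rw [vseq, Nat.cast_sub hle, sub_div]

lemma tendsto_wseq_mul_atTop (hq0 : Tendsto q atTop (𝓝 0))
    (hq : Tendsto (fun n : ℕ => (n : ℝ) * q n) atTop atTop)
    (hu : Tendsto (fun n : ℕ => (u n : ℝ) / ((n : ℝ) * q n)) atTop (𝓝 1)) :
    Tendsto (fun n : ℕ => (wseq u n : ℝ) * q n) atTop atTop := by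
  refine ((tendsto_wseq_div hq0 hq hu).pos_mul_atTop one_pos hq).congr' ?_
  filter_upwards [eventually_pos_of_tendsto_mul_atTop hq] with n ⟨hn, _⟩
  field_simp

lemma tendsto_wseq_mul_div_sqrt_vseq (hβ : β ∈ Ioo (0 : ℝ) 1) (hq0 : Tendsto q atTop (𝓝 0))
    (hq : Tendsto (fun n : ℕ => (n : ℝ) * q n) atTop atTop)
    (hq2 : Tendsto (fun n : ℕ => (n : ℝ) * q n ^ (2 - β)) atTop (𝓝 0))
    (hu : Tendsto (fun n : ℕ => (u n : ℝ) / ((n : ℝ) * q n)) atTop (𝓝 1)) :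
    Tendsto (fun n : ℕ => (wseq u n : ℝ) * q n / Real.sqrt (vseq u β n)) atTop (𝓝 0) := by
  have h := (((tendsto_wseq_div hq0 hq hu).pow 2).mul hq2).div
    (tendsto_vseq_div hβ hq0 hq hu) one_ne_zero
  rw [mul_zero, zero_div] at h
  have h' := h.sqrt
  rw [Real.sqrt_zero] at h'
  refine h'.congr' ?_
  filter_upwards [eventually_pos_of_tendsto_mul_atTop hq] with n ⟨hn, hqn⟩
  rw [← Real.sqrt_sq (show 0 ≤ (wseq u n : ℝ) * q n by positivity),
    ← Real.sqrt_div (sq_nonneg _)]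
  congr 1
  simp only [Pi.div_apply]
  rw [Real.rpow_sub hqn, Real.rpow_two]
  field_simp

lemma tendsto_vseq_div_wseq (hβ : β ∈ Ioo (0 : ℝ) 1) (hq0 : Tendsto q atTop (𝓝 0))
    (hq : Tendsto (fun n : ℕ => (n : ℝ) * q n) atTop atTop)
    (hu : Tendsto (fun n : ℕ => (u n : ℝ) / ((n : ℝ) * q n)) atTop (𝓝 1)) :
    Tendsto (fun n : ℕ => (vseq u β n : ℝ) / (wseq u n : ℝ)) atTop (𝓝 0) := by
  have h := ((tendsto_vseq_div hβ hq0 hq hu).mul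
    (hq0.rpow_const (p := β) (Or.inr hβ.1.le))).div (tendsto_wseq_div hq0 hq hu) one_ne_zero
  rw [Real.zero_rpow hβ.1.ne', mul_zero, zero_div] at h
  refine h.congr' ?_
  filter_upwards [eventually_pos_of_tendsto_mul_atTop hq] with n ⟨hn, hqn⟩
  simp only [Pi.div_apply]
  field_simp

end RateComparison

/-- Under Assumptions B and C, if `u_n ∼ n P(H > γ M_n)`, `w_n = n - u_n` and
`v_n = ⌊n^{1-β} u_n^β⌋ - u_n`, then `1 ≪ w_n P(H > γ M_n) ≪ √v_n ≪ √w_n`. -/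
theorem wn_vn_rate_comparison
    {Ω : Type*} [MeasureSpace Ω] [IsProbabilityMeasure (ℙ : Measure Ω)]
    (H0 : Ω → ℝ) (hH0meas : Measurable H0) (hH0nn : ∀ ω, 0 ≤ H0 ω)
    (α β γ : ℝ) (hα : 0 < α) (hβ : β ∈ Ioo (0:ℝ) 1) (hγ : γ ∈ Ioo (0:ℝ) 1)
    (hreg : RegVarTail H0 α)
    (M : ℕ → ℝ) (hMpos : ∀ n, 0 < M n) (hMtop : Tendsto M atTop atTop)
    (hB : AssumpB H0 M) (hC : AssumpC H0 M β)
    (u : ℕ → ℕ)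
    (hu : Tendsto (fun n : ℕ => (u n : ℝ) / ((n : ℝ) * tailP H0 (γ * M n))) atTop (𝓝 1))
 :
    Tendsto (fun n : ℕ => (wseq u n : ℝ) * tailP H0 (γ * M n)) atTop atTop ∧
    Tendsto (fun n : ℕ => (wseq u n : ℝ) * tailP H0 (γ * M n) / Real.sqrt (vseq u β n))
      atTop (𝓝 0) ∧
    Tendsto (fun n : ℕ => (vseq u β n : ℝ) / (wseq u n : ℝ)) atTop (𝓝 0) := by
  have hpos := eventually_pos_of_tendsto_mul_atTop hB
  have hq0 : Tendsto (fun n => tailP H0 (γ * M n)) atTop (𝓝 0) :=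
    (tendsto_tailP_atTop hH0meas).comp (hMtop.const_mul_atTop hγ.1)
  have hratio : Tendsto (fun n => tailP H0 (γ * M n) / tailP H0 (M n)) atTop (𝓝 (γ ^ (-α))) := by
    simpa only [Function.comp_def, mul_comm] using (hreg γ hγ.1).comp hMtop
  have hγα : 0 < γ ^ (-α) := Real.rpow_pos_of_pos hγ.1 _
  have hq : Tendsto (fun n : ℕ => (n : ℝ) * tailP H0 (γ * M n)) atTop atTop := by
    refine (hratio.pos_mul_atTop hγα hB).congr' ?_
    filter_upwards [hpos] with n ⟨hn, hp⟩
    field_simp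
  have hlog : Tendsto (fun n => Real.log (M n) ^ 2) atTop atTop :=
    (tendsto_pow_atTop two_ne_zero).comp (Real.tendsto_log_atTop.comp hMtop)
  have hq2 : Tendsto (fun n : ℕ => (n : ℝ) * tailP H0 (γ * M n) ^ (2 - β)) atTop (𝓝 0) := by
    have h := (hC.mul hlog.inv_tendsto_atTop).mul
      (hratio.rpow_const (p := 2 - β) (Or.inl hγα.ne'))
    rw [zero_mul, zero_mul] at h
    refine h.congr' ?_
    filter_upwards [hpos, hlog.eventually_gt_atTop 0,
      eventually_pos_of_tendsto_mul_atTop hq] with n ⟨hn, hp⟩ hl ⟨_, hqn⟩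
    rw [Real.div_rpow hqn.le hp.le, Pi.inv_apply, mul_inv_cancel_right₀ hl.ne']
    field_simp
  exact ⟨tendsto_wseq_mul_atTop hq0 hq hu, tendsto_wseq_mul_div_sqrt_vseq hβ hq0 hq hq2 hu,
    tendsto_vseq_div_wseq hβ hq0 hq hu⟩
end
end

section
/- Under Assumptions B and C, if (u_n) is a sequence of integers with u_n ∼ n P(H > γM_n), w_n := n − u_n and v_n := [n^{1−β} u_n^β] − u_n, then b(w_n/v_n) = o(γM_n) as n → ∞; that is, b(w_n/v_n)/M_n → 0. -/
open MeasureTheory ProbabilityTheory Filter Topology Set Asymptotics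

noncomputable section

variable {Ω : Type*} [MeasureSpace Ω]

lemma tailP_nonneg {Ω : Type*} [MeasureSpace Ω] (Z : Ω → ℝ) (x : ℝ) : 0 ≤ tailP Z x :=
  ENNReal.toReal_nonneg

lemma tailP_of_neg {Ω : Type*} [MeasureSpace Ω] [IsProbabilityMeasure (ℙ : Measure Ω)]
    {Z : Ω → ℝ} (hZ : ∀ ω, 0 ≤ Z ω) {x : ℝ} (hx : x < 0) : tailP Z x = 1 := by
  have h : {ω | Z ω > x} = univ := eq_univ_of_forall fun ω => hx.trans_le (hZ ω)
  simp [tailP, h]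

lemma bq_of_le_one {Ω : Type*} [MeasureSpace Ω] [IsProbabilityMeasure (ℙ : Measure Ω)]
    {Z : Ω → ℝ} (hZ : ∀ ω, 0 ≤ Z ω) {y : ℝ} (hy : y ≤ 1) : bq Z y = 0 := by
  refine Real.sInf_of_not_bddBelow fun ⟨c, hc⟩ => ?_
  have hneg : min (c - 1) (-1) < 0 := (min_le_right _ _).trans_lt (by norm_num)
  have hmem : min (c - 1) (-1) ∈ {x : ℝ | 1 / tailP Z x ≥ y} := by
    simpa [tailP_of_neg hZ hneg] using hy
  linarith [hc hmem, min_le_left (c - 1) (-1)]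

lemma nonneg_of_one_div_tailP_ge {Ω : Type*} [MeasureSpace Ω]
    [IsProbabilityMeasure (ℙ : Measure Ω)] {Z : Ω → ℝ} (hZ : ∀ ω, 0 ≤ Z ω) {x y : ℝ}
    (hy : 1 < y) (hx : 1 / tailP Z x ≥ y) : 0 ≤ x := by
  by_contra! h
  rw [tailP_of_neg hZ h] at hx
  linarith

lemma bq_nonneg {Ω : Type*} [MeasureSpace Ω] [IsProbabilityMeasure (ℙ : Measure Ω)]
    {Z : Ω → ℝ} (hZ : ∀ ω, 0 ≤ Z ω) (y : ℝ) : 0 ≤ bq Z y := by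
  rcases le_or_gt y 1 with hy | hy
  · exact (bq_of_le_one hZ hy).ge
  · exact Real.sInf_nonneg fun x hx => nonneg_of_one_div_tailP_ge hZ hy hx

lemma bq_le {Ω : Type*} [MeasureSpace Ω] [IsProbabilityMeasure (ℙ : Measure Ω)]
    {Z : Ω → ℝ} (hZ : ∀ ω, 0 ≤ Z ω) {x y : ℝ} (hx : 0 ≤ x) (hxy : y ≤ 1 / tailP Z x) :
    bq Z y ≤ x := by
  rcases le_or_gt y 1 with hy | hy
  · exact (bq_of_le_one hZ hy).trans_le hx
  · exact csInf_le ⟨0, fun z hz => nonneg_of_one_div_tailP_ge hZ hy hz⟩ hxy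

/-- A lower bound for the number of intermediate order statistics. -/
lemma vseq_div_ge (u : ℕ → ℕ) (β : ℝ) {n : ℕ} (hn : 0 < n) :
    ((u n : ℝ) / n) ^ β - (u n : ℝ) / n - 1 / n ≤ (vseq u β n : ℝ) / n := by
  have hn' : (0 : ℝ) < n := Nat.cast_pos.2 hn
  have hfloor := Nat.sub_one_lt_floor ((n : ℝ) ^ (1 - β) * (u n : ℝ) ^ β)
  have hsub : ((⌊(n : ℝ) ^ (1 - β) * (u n : ℝ) ^ β⌋₊ : ℕ) : ℝ) - u n ≤ vseq u β n := by
    rw [vseq, sub_le_iff_le_add]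
    exact_mod_cast Nat.le_add_of_sub_le le_rfl
  have hpow : (n : ℝ) ^ (1 - β) * (u n : ℝ) ^ β = n * ((u n : ℝ) / n) ^ β := by
    rw [Real.div_rpow (Nat.cast_nonneg _) hn'.le, Real.rpow_sub hn', Real.rpow_one]
    ring
  rw [hpow] at hfloor hsub
  rw [le_div_iff₀ hn']
  have : (((u n : ℝ) / n) ^ β - (u n : ℝ) / n - 1 / n) * n
      = n * ((u n : ℝ) / n) ^ β - 1 - u n := by
    field_simp
    ring
  linarith

/-- If `p` and `q` are of the order of `t → 0⁺`, and `r` is at most of that order, then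
`p ^ β` eventually dominates `p + q + r` for `β < 1`. -/
lemma eventually_add_le_rpow {ι : Type*} {l : Filter ι} {p q r t : ι → ℝ} {β c d e : ℝ}
    (hβ : β < 1) (hc : 0 < c) (ht : Tendsto t l (𝓝 0)) (htpos : ∀ᶠ i in l, 0 < t i)
    (hp : Tendsto (fun i => p i / t i) l (𝓝 c)) (hq : Tendsto (fun i => q i / t i) l (𝓝 d))
    (hr : Tendsto (fun i => r i / t i) l (𝓝 e)) :
    ∀ᶠ i in l, p i + q i + r i ≤ p i ^ β := by
  have hsmall : Tendsto (fun i => (p i / t i + q i / t i + r i / t i) * t i ^ (1 - β)) l (𝓝 0) := by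
    have h := ht.rpow_const (p := 1 - β) (Or.inr (by linarith))
    rw [Real.zero_rpow (by linarith)] at h
    simpa using ((hp.add hq).add hr).mul h
  have hbig : Tendsto (fun i => (p i / t i) ^ β) l (𝓝 (c ^ β)) :=
    hp.rpow_const (Or.inl hc.ne')
  filter_upwards [hsmall.eventually_lt hbig (Real.rpow_pos_of_pos hc β), htpos,
    hp.eventually (lt_mem_nhds hc)] with i hi hti hpi
  have hppos : 0 < p i := (div_pos_iff_of_pos_right hti).1 hpi
  rw [Real.div_rpow hppos.le hti.le, lt_div_iff₀ (Real.rpow_pos_of_pos hti β), mul_assoc,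
    ← Real.rpow_add hti, sub_add_cancel, Real.rpow_one, ← add_div, ← add_div,
    div_mul_cancel₀ _ hti.ne'] at hi
  exact hi.le

/-- Under Assumptions B and C, `b(w_n/v_n) = o(γ M_n)`, i.e. `b(w_n/v_n)/M_n → 0`. -/
theorem bq_littleO_truncation_level
    {Ω : Type*} [MeasureSpace Ω] [IsProbabilityMeasure (ℙ : Measure Ω)]
    (H0 : Ω → ℝ) (hH0meas : Measurable H0) (hH0nn : ∀ ω, 0 ≤ H0 ω)
    (α β γ : ℝ) (hα : 0 < α) (hβ : β ∈ Ioo (0:ℝ) 1) (hγ : γ ∈ Ioo (0:ℝ) 1)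
    (hreg : RegVarTail H0 α)
    (M : ℕ → ℝ) (hMpos : ∀ n, 0 < M n) (hMtop : Tendsto M atTop atTop)
    (hB : AssumpB H0 M) (hC : AssumpC H0 M β)
    (u : ℕ → ℕ)
    (hu : Tendsto (fun n : ℕ => (u n : ℝ) / ((n : ℝ) * tailP H0 (γ * M n))) atTop (𝓝 1))
 :
    Tendsto (fun n : ℕ => bq H0 ((wseq u n : ℝ) / (vseq u β n : ℝ)) / M n) atTop (𝓝 0) := by
  set t : ℕ → ℝ := fun n => tailP H0 (M n) with ht_def
  have ht : Tendsto t atTop (𝓝 0) := (tendsto_tailP_atTop hH0meas).comp hMtop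
  have htpos : ∀ᶠ n in atTop, 0 < t n := by
    filter_upwards [hB.eventually_gt_atTop 0] with n hn
    exact pos_of_mul_pos_right hn (Nat.cast_nonneg n)
  have hratio (x : ℝ) (hx : 0 < x) :
      Tendsto (fun n => tailP H0 (x * M n) / t n) atTop (𝓝 (x ^ (-α))) := by
    simpa [Function.comp_def, mul_comm, ht_def] using (hreg x hx).comp hMtop
  have hcγ : 0 < γ ^ (-α) := Real.rpow_pos_of_pos hγ.1 _
  have hp : Tendsto (fun n : ℕ => (u n : ℝ) / n / t n) atTop (𝓝 (γ ^ (-α))) := by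
    have h := hu.mul (hratio γ hγ.1)
    rw [one_mul] at h
    refine h.congr' ?_
    filter_upwards [(hratio γ hγ.1).eventually (lt_mem_nhds hcγ), htpos] with n hn htn
    have hγn : tailP H0 (γ * M n) ≠ 0 := ((div_pos_iff_of_pos_right htn).1 hn).ne'
    field_simp
  have hinv : Tendsto (fun n : ℕ => 1 / (n : ℝ) / t n) atTop (𝓝 0) := by
    refine (tendsto_inv_atTop_zero.comp hB).congr fun n => ?_
    simp [ht_def, div_eq_mul_inv, mul_comm]
  refine tendsto_order.2 ⟨fun a ha => Eventually.of_forall fun n =>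
    ha.trans_le (div_nonneg (bq_nonneg hH0nn _) (hMpos n).le), fun a ha => ?_⟩
  have ha2 : 0 < a / 2 := half_pos ha
  filter_upwards [eventually_add_le_rpow hβ.2 hcγ ht htpos hp hinv (hratio (a / 2) ha2),
    (hratio (a / 2) ha2).eventually (lt_mem_nhds (Real.rpow_pos_of_pos ha2 (-α))), htpos,
    eventually_gt_atTop 0] with n hn hpos htn hn0
  have hTpos : 0 < tailP H0 (a / 2 * M n) := (div_pos_iff_of_pos_right htn).1 hpos
  have hn' : (0 : ℝ) < n := Nat.cast_pos.2 hn0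
  have hTv : tailP H0 (a / 2 * M n) ≤ (vseq u β n : ℝ) / n := by
    linarith [vseq_div_ge u β hn0]
  have hle : (wseq u n : ℝ) / (vseq u β n : ℝ) ≤ 1 / tailP H0 (a / 2 * M n) :=
    calc (wseq u n : ℝ) / (vseq u β n : ℝ) ≤ n / (vseq u β n : ℝ) := by
          gcongr
          exact Nat.sub_le _ _
      _ = 1 / ((vseq u β n : ℝ) / n) := (one_div_div _ _).symm
      _ ≤ 1 / tailP H0 (a / 2 * M n) := one_div_le_one_div_of_le hTpos hTv
  have hb := bq_le hH0nn (mul_pos ha2 (hMpos n)).le hle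
  calc _ ≤ a / 2 := (div_le_iff₀ (hMpos n)).2 hb
    _ < a := half_lt_self ha
end
end
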